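/- arXiv:math/0610347 — 2 statements merged into one kernel-verified Lean document; each statement's English description precedes it below -/
import Mathlib

section
/- Let L be a finite-dimensional 2-soluble n-Lie algebra and let A be a minimal abelian embedded ideal of L with C_L(A) = A. Then any two complements to A in L (subalgebras U with U + A = L and U ∩ A = 0) are A-conjugate. -/
namespace NLie

open Finset

variable {F : Type*} [Field F] {L : Type*} [AddCommGroup L] [Module F L] {n : ℕ}

/-- The generalized Jacobi identity for an `(n+2)`-ary alternating bracket:
`[y₁,…,y_{n+1},[x₁,…,x_{n+2}]] = ∑ᵢ [x₁,…,[y₁,…,y_{n+1},xᵢ],…,x_{n+2}]`.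
(This is the identity (1) of the paper, rewritten with the string `y` in the
first `n+1` slots, which is equivalent since the bracket is alternating.) -/
def IsNLie (f : AlternatingMap F L L (Fin (n + 2))) : Prop :=
  ∀ (y : Fin (n + 1) → L) (x : Fin (n + 2) → L),
    f (Fin.snoc y (f x)) = ∑ i, f (Function.update x i (f (Fin.snoc y (x i))))

/-- `d : L → L` is a derivation of the bracket `f`. -/
def IsDerivation (f : AlternatingMap F L L (Fin (n + 2))) (d : L →ₗ[F] L) : Prop :=
  ∀ x : Fin (n + 2) → L, d (f x) = ∑ i, f (Function.update x i (d (x i)))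

/-- The (inner) derivation `D(a₁,…,a_{n+1}) : x ↦ [a₁,…,a_{n+1},x]`. -/
def D (f : AlternatingMap F L L (Fin (n + 2))) (a : Fin (n + 1) → L) : L →ₗ[F] L where
  toFun x := f (Fin.snoc a x)
  map_add' x y := by
    have h := f.toMultilinearMap.map_update_add (Fin.snoc a x) (Fin.last (n + 1)) x y
    simpa [Fin.update_snoc_last] using h
  map_smul' c x := by
    have h := f.toMultilinearMap.map_update_smul (Fin.snoc a x) (Fin.last (n + 1)) c x
    simpa [Fin.update_snoc_last] using h

/-- `D(U)`: the span of all inner derivations `D(a₁,…,a_{n+1})` with all `aᵢ ∈ U`. -/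
def Dspan (f : AlternatingMap F L L (Fin (n + 2))) (U : Submodule F L) :
    Submodule F (L →ₗ[F] L) :=
  Submodule.span F {d | ∃ a : Fin (n + 1) → L, (∀ i, a i ∈ U) ∧ d = D f a}

/-- The Engel subspace `E_L(d) = {x ∈ L ∣ dʳ x = 0 for some r}`. -/
def engel (d : L →ₗ[F] L) : Submodule F L where
  carrier := {x | ∃ r, (d ^ r) x = 0}
  zero_mem' := ⟨0, map_zero _⟩
  add_mem' := by
    rintro a b ⟨r, hr⟩ ⟨s, hs⟩
    refine ⟨r + s, ?_⟩
    have h1 : (d ^ (r + s)) a = (d ^ s) ((d ^ r) a) := by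
      rw [add_comm r s, pow_add]; rfl
    have h2 : (d ^ (r + s)) b = (d ^ r) ((d ^ s) b) := by
      rw [pow_add]; rfl
    rw [map_add, h1, h2, hr, hs, map_zero, map_zero, add_zero]
  smul_mem' := by
    rintro c a ⟨r, hr⟩
    exact ⟨r, by rw [map_smul, hr, smul_zero]⟩

/-- `E` is an Engel subalgebra of `L`: `E = E_L(d)` for some inner derivation `d ∈ D(E)`. -/
def IsEngel (f : AlternatingMap F L L (Fin (n + 2))) (E : Submodule F L) : Prop :=
  ∃ d : L →ₗ[F] L, d ∈ Dspan f E ∧ E = engel d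

/-- `[A₁,…,A_{n+2}]`: the subspace spanned by all brackets with `aᵢ ∈ Aᵢ`. -/
def bracketSpan (f : AlternatingMap F L L (Fin (n + 2))) (A : Fin (n + 2) → Submodule F L) :
    Submodule F L :=
  Submodule.span F {z | ∃ a : Fin (n + 2) → L, (∀ i, a i ∈ A i) ∧ f a = z}

/-- `K` is a subalgebra of `L`. -/
def IsSubalg (f : AlternatingMap F L L (Fin (n + 2))) (K : Submodule F L) : Prop :=
  ∀ a : Fin (n + 2) → L, (∀ i, a i ∈ K) → f a ∈ K

/-- `K` is an ideal of `L` : `[K,L,…,L] ⊆ K`. -/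
def IsIdeal (f : AlternatingMap F L L (Fin (n + 2))) (K : Submodule F L) : Prop :=
  ∀ a : Fin (n + 2) → L, a 0 ∈ K → f a ∈ K

/-- `V` is an ideal of the subalgebra `W`. -/
def IsIdealIn (f : AlternatingMap F L L (Fin (n + 2))) (V W : Submodule F L) : Prop :=
  V ≤ W ∧ ∀ a : Fin (n + 2) → L, a 0 ∈ V → (∀ i, a i ∈ W) → f a ∈ V

/-- `M` is a maximal proper subalgebra of `L`. -/
def IsMaximalSubalg (f : AlternatingMap F L L (Fin (n + 2))) (M : Submodule F L) : Prop :=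
  IsSubalg f M ∧ M ≠ ⊤ ∧ ∀ U : Submodule F L, IsSubalg f U → M < U → U = ⊤

/-- The Frattini subalgebra: the intersection of all maximal proper subalgebras. -/
def frattini (f : AlternatingMap F L L (Fin (n + 2))) : Submodule F L :=
  sInf {M | IsMaximalSubalg f M}

/-- The lower central series of a subalgebra `U`:
`U¹ = U`, `U^{s+1} = [Uˢ, U,…,U]`. (`lcsIn f U s` is `U^{s+1}`.) -/
def lcsIn (f : AlternatingMap F L L (Fin (n + 2))) (U : Submodule F L) : ℕ → Submodule F L
  | 0 => U
  | s + 1 => bracketSpan f (Fin.cons (lcsIn f U s) fun _ => U)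

/-- `L` is a nilpotent `(n+2)`-Lie algebra. -/
def IsNilpotentAlg (f : AlternatingMap F L L (Fin (n + 2))) : Prop :=
  ∃ r, lcsIn f ⊤ r = ⊥

/-- The lower central series of `U` modulo `K`: `U/K` is nilpotent iff some term
of this series is contained in `K`. -/
def lcsMod (f : AlternatingMap F L L (Fin (n + 2))) (U K : Submodule F L) : ℕ → Submodule F L
  | 0 => U
  | s + 1 => bracketSpan f (Fin.cons (lcsMod f U K s) fun _ => U) ⊔ K

/-- The series `K¹ = K`, `K^{s+1} = [Kˢ, K, L,…,L]` used to define
"2-nilpotently embedded". -/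
def nes2 (f : AlternatingMap F L L (Fin (n + 2))) (K : Submodule F L) : ℕ → Submodule F L
  | 0 => K
  | s + 1 => bracketSpan f (Fin.cons (nes2 f K s) (Fin.cons K fun _ => ⊤))

/-- The series of `B` modulo `A`, so that `B/A` is 2-nilpotently embedded in `L/A`
iff some term of this series is contained in `A`. -/
def nes2Mod (f : AlternatingMap F L L (Fin (n + 2))) (B A : Submodule F L) : ℕ → Submodule F L
  | 0 => B
  | s + 1 => bracketSpan f (Fin.cons (nes2Mod f B A s) (Fin.cons B fun _ => ⊤)) ⊔ A

/-- The 2-derived series: `L⁽⁰⁾ = L`, `L⁽ˢ⁺¹⁾ = [L⁽ˢ⁾, L⁽ˢ⁾, L,…,L]`. -/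
def ds2 (f : AlternatingMap F L L (Fin (n + 2))) : ℕ → Submodule F L
  | 0 => ⊤
  | s + 1 => bracketSpan f (Fin.cons (ds2 f s) (Fin.cons (ds2 f s) fun _ => ⊤))

/-- `L` is 2-soluble. -/
def Is2Soluble (f : AlternatingMap F L L (Fin (n + 2))) : Prop :=
  ∃ r, ds2 f r = ⊥

/-- The `k`-derived series of an ideal `K`:
`K⁽⁰⁾ = K`, `K⁽ˢ⁺¹⁾ = [(k)K⁽ˢ⁾, (n+2-k)L]`: `K` is `k`-solubly embedded in `L`
iff some term vanishes. -/
def dsk (f : AlternatingMap F L L (Fin (n + 2))) (k : ℕ) (K : Submodule F L) :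
    ℕ → Submodule F L
  | 0 => K
  | s + 1 => bracketSpan f (fun i => if (i : ℕ) < k then dsk f k K s else ⊤)

/-- The `k`-derived series of `A` modulo `B`: `A/B` is `k`-solubly embedded in `L/B`
iff some term of this series is contained in `B`. -/
def dskMod (f : AlternatingMap F L L (Fin (n + 2))) (k : ℕ) (A B : Submodule F L) :
    ℕ → Submodule F L
  | 0 => A
  | s + 1 => bracketSpan f (fun i => if (i : ℕ) < k then dskMod f k A B s else ⊤) ⊔ B

/-- The ideal `A` is abelian embedded in `L`: `[A,A,L,…,L] = 0`. -/
def IsAbelianEmbedded (f : AlternatingMap F L L (Fin (n + 2))) (A : Submodule F L) : Prop :=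
  ∀ a : Fin (n + 2) → L, a 0 ∈ A → a 1 ∈ A → f a = 0

/-- `A` is a minimal abelian embedded ideal of `L`: a nonzero abelian embedded ideal
whose only properly contained ideal is `0`. -/
def IsMinAbelianEmbeddedIdeal (f : AlternatingMap F L L (Fin (n + 2)))
    (A : Submodule F L) : Prop :=
  A ≠ ⊥ ∧ IsIdeal f A ∧ IsAbelianEmbedded f A ∧
    ∀ B : Submodule F L, IsIdeal f B → B < A → B = ⊥

/-- The normalizer `N_L(U) = {x ∈ L ∣ [x,u₁,…,u_{n+1}] ∈ U for all uᵢ ∈ U}`. -/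
def normalizer (f : AlternatingMap F L L (Fin (n + 2))) (U : Submodule F L) : Set L :=
  {x | ∀ u : Fin (n + 1) → L, (∀ i, u i ∈ U) → f (Fin.cons x u) ∈ U}

/-- The centralizer `C_L(A) = {c ∈ L ∣ [c,a,x₃,…,x_{n+2}] = 0 for all a ∈ A, xᵢ ∈ L}`. -/
def centralizer (f : AlternatingMap F L L (Fin (n + 2))) (A : Submodule F L) : Set L :=
  {c | ∀ a ∈ A, ∀ x : Fin n → L, f (Fin.cons c (Fin.cons a x)) = 0}

/-- `S` is a Cartan subalgebra of `L`: a nilpotent self-normalizing subalgebra. -/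
def IsCartan (f : AlternatingMap F L L (Fin (n + 2))) (S : Submodule F L) : Prop :=
  IsSubalg f S ∧ (∃ r, lcsIn f S r = ⊥) ∧ normalizer f S = (S : Set L)

/-- `U` is a subnormal subalgebra of `L`. -/
def IsSubnormal (f : AlternatingMap F L L (Fin (n + 2))) (U : Submodule F L) : Prop :=
  ∃ (r : ℕ) (C : ℕ → Submodule F L), C 0 = U ∧ C r = ⊤ ∧
    (∀ i ≤ r, IsSubalg f (C i)) ∧ ∀ i < r, IsIdealIn f (C i) (C (i + 1))

/-- An `A`-inner automorphism: a finite product of maps `1 + D(a,x₂,…,x_{n+1})`,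
`a ∈ A`, where `A` is an abelian embedded ideal. -/
def IsAInner (f : AlternatingMap F L L (Fin (n + 2))) (A : Submodule F L)
    (α : L →ₗ[F] L) : Prop :=
  ∃ (m : ℕ) (g : Fin m → (L →ₗ[F] L)),
    (∀ j, ∃ (a : L) (x : Fin n → L), a ∈ A ∧ g j = LinearMap.id + D f (Fin.cons a x)) ∧
    α = (List.ofFn g).prod

section Brackets

variable {f : AlternatingMap F L L (Fin (n + 2))}

theorem D_apply (u : Fin (n + 1) → L) (x : L) : D f u x = f (Fin.snoc u x) := rfl

theorem map_perm_mem_iff (M : Submodule F L) (z : Fin (n + 2) → L)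
    (σ : Equiv.Perm (Fin (n + 2))) : f (z ∘ σ) ∈ M ↔ f z ∈ M := by
  rw [f.map_perm]
  rcases Int.units_eq_one_or (Equiv.Perm.sign σ) with h | h <;> simp [h]

theorem IsIdeal.map_mem {K : Submodule F L} (hK : IsIdeal f K) {z : Fin (n + 2) → L}
    (i : Fin (n + 2)) (hz : z i ∈ K) : f z ∈ K := by
  rw [← map_perm_mem_iff K z (Equiv.swap 0 i)]
  exact hK _ (by simpa using hz)

theorem IsIdeal.D_mem {K : Submodule F L} (hK : IsIdeal f K) (u : Fin (n + 1) → L) {x : L}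
    (hx : x ∈ K) : D f u x ∈ K :=
  hK.map_mem (Fin.last _) (by simpa using hx)

theorem IsIdeal.D_mem_of_mem {K : Submodule F L} (hK : IsIdeal f K) {u : Fin (n + 1) → L}
    (i : Fin (n + 1)) (hu : u i ∈ K) (x : L) : D f u x ∈ K :=
  hK.map_mem i.castSucc (by simpa using hu)

theorem isIdeal_of_D_mem {K : Submodule F L}
    (h : ∀ (u : Fin (n + 1) → L), ∀ x ∈ K, D f u x ∈ K) : IsIdeal f K := by
  intro a ha
  rw [← map_perm_mem_iff K a (Equiv.swap 0 (Fin.last _)),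
    ← Fin.snoc_init_self (a ∘ Equiv.swap 0 (Fin.last _))]
  exact h _ _ (by simpa using ha)

theorem map_mem_of_pair {K M : Submodule F L}
    (h : ∀ a : Fin (n + 2) → L, a 0 ∈ K → a 1 ∈ K → f a ∈ M) {z : Fin (n + 2) → L}
    {i j : Fin (n + 2)} (hij : i ≠ j) (hi : z i ∈ K) (hj : z j ∈ K) : f z ∈ M := by
  have hne : (0 : Fin (n + 2)) ≠ Equiv.swap 0 i j := by
    intro h0
    apply hij
    have := congrArg (Equiv.swap 0 i) h0
    simpa using this
  rw [← map_perm_mem_iff M z (Equiv.swap 0 i * Equiv.swap 1 (Equiv.swap 0 i j))]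
  refine h _ ?_ ?_
  · have : Equiv.swap 1 (Equiv.swap 0 i j) (0 : Fin (n + 2)) = 0 :=
      Equiv.swap_apply_of_ne_of_ne (by simp) hne
    simpa [this] using hi
  · simpa using hj

theorem IsAbelianEmbedded.map_eq_zero {A : Submodule F L} (hA : IsAbelianEmbedded f A)
    {z : Fin (n + 2) → L} {i j : Fin (n + 2)} (hij : i ≠ j) (hi : z i ∈ A) (hj : z j ∈ A) :
    f z = 0 := by
  rw [← Submodule.mem_bot F]
  exact map_mem_of_pair (fun a h0 h1 => (Submodule.mem_bot F).2 (hA a h0 h1)) hij hi hj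

theorem IsAbelianEmbedded.D_eq_zero {A : Submodule F L} (hA : IsAbelianEmbedded f A)
    {u : Fin (n + 1) → L} {i : Fin (n + 1)} (hi : u i ∈ A) {x : L} (hx : x ∈ A) :
    D f u x = 0 :=
  hA.map_eq_zero (Fin.castSucc_lt_last i).ne (by simpa using hi) (by simpa using hx)

theorem IsNLie.D_map (hf : IsNLie f) (u : Fin (n + 1) → L) : IsDerivation f (D f u) :=
  fun x => hf u x

theorem IsNLie.D_D (hf : IsNLie f) (u w : Fin (n + 1) → L) (x : L) :
    D f u (D f w x) =
      D f w (D f u x) + (∑ i, D f (Function.update w i (D f u (w i)))) x := by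
  rw [D_apply w x, hf.D_map u, Fin.sum_univ_castSucc, add_comm, LinearMap.sum_apply]
  congr 1
  · rw [Fin.snoc_last, Fin.update_snoc_last, D_apply w]
  · refine Finset.sum_congr rfl fun i _ => ?_
    rw [D_apply (Function.update w i _), Fin.snoc_update, Fin.snoc_castSucc]

/-- The map `u ↦ D(u)` is multilinear. -/
theorem curryRight_eq_D (u : Fin (n + 1) → L) : f.toMultilinearMap.curryRight u = D f u := rfl

theorem sub_mem_of_congr {ι M : Type*} [Fintype ι] [DecidableEq ι] [AddCommGroup M] [Module F M]
    (g : MultilinearMap F (fun _ : ι => L) M) {A : Submodule F L} {K : Submodule F M}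
    (h : ∀ z i, z i ∈ A → g z ∈ K) {x y : ι → L} (hxy : ∀ i, x i - y i ∈ A) :
    g x - g y ∈ K := by
  have key : ∀ s : Finset ι, g (s.piecewise x y) - g y ∈ K := by
    intro s
    induction s using Finset.induction_on with
    | empty => simp
    | insert i s hi ih =>
      rw [Finset.piecewise_insert]
      have hd : g (Function.update (s.piecewise x y) i (x i - y i)) ∈ K :=
        h _ i (by simpa using hxy i)
      rw [g.map_update_sub] at hd
      have he : Function.update (s.piecewise x y) i (y i) = s.piecewise x y := by
        rw [Function.update_eq_self_iff]
        simp [hi]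
      rw [he] at hd
      simpa using K.add_mem hd ih
  simpa using key Finset.univ

theorem D_sub_D_mem {A : Submodule F L} (hI : IsIdeal f A) {u w : Fin (n + 1) → L}
    (h : ∀ i, u i - w i ∈ A) (x : L) : D f u x - D f w x ∈ A :=
  sub_mem_of_congr f.toMultilinearMap.curryRight (A := A) (K := A.comap (LinearMap.applyₗ x))
    (fun _ i hz => hI.D_mem_of_mem i hz x) h

theorem IsAbelianEmbedded.D_congr {A : Submodule F L} (hA : IsAbelianEmbedded f A)
    {u w : Fin (n + 1) → L} (h : ∀ i, u i - w i ∈ A) {x : L} (hx : x ∈ A) :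
    D f u x = D f w x :=
  sub_eq_zero.1 <| (Submodule.mem_bot F).1 <|
    sub_mem_of_congr f.toMultilinearMap.curryRight (A := A)
      (K := (⊥ : Submodule F L).comap (LinearMap.applyₗ x))
      (fun _ _ hz => (Submodule.mem_bot F).2 (hA.D_eq_zero hz hx)) h

theorem IsAbelianEmbedded.map_congr {A : Submodule F L} (hA : IsAbelianEmbedded f A)
    {x y : Fin (n + 2) → L} (h : ∀ i, x i - y i ∈ A) {i : Fin (n + 2)} (hxi : x i ∈ A)
    (hi : x i = y i) : f x = f y := by
  have key : f (x ∘ Equiv.swap i (Fin.last _)) = f (y ∘ Equiv.swap i (Fin.last _)) := by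
    rw [← Fin.snoc_init_self (x ∘ Equiv.swap i (Fin.last _)),
      ← Fin.snoc_init_self (y ∘ Equiv.swap i (Fin.last _))]
    simp only [Function.comp_apply, Equiv.swap_apply_right, ← hi]
    exact hA.D_congr (fun j => h _) hxi
  rw [f.map_perm, f.map_perm] at key
  exact smul_left_cancel _ key

theorem IsAbelianEmbedded.map_add {A : Submodule F L} (hA : IsAbelianEmbedded f A)
    (x : Fin (n + 2) → L) {y : Fin (n + 2) → L} (hy : ∀ i, y i ∈ A) :
    f (x + y) = f x + ∑ i, f (Function.update x i (y i)) := by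
  have key : ∀ s : Finset (Fin (n + 2)),
      f (s.piecewise (x + y) x) = f x + ∑ i ∈ s, f (Function.update x i (y i)) := by
    intro s
    induction s using Finset.induction_on with
    | empty => simp
    | insert i s hi ih =>
      have he : Function.update (s.piecewise (x + y) x) i (x i) = s.piecewise (x + y) x := by
        rw [Function.update_eq_self_iff]
        simp [hi]
      have hy' : f (Function.update (s.piecewise (x + y) x) i (y i)) =
          f (Function.update x i (y i)) := by
        refine hA.map_congr (i := i) (fun j => ?_) (by simpa using hy i) (by simp)
        rcases eq_or_ne j i with rfl | hj
        · simp
        · by_cases hs : j ∈ s <;> simp [hj, hs, hy j]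
      rw [Finset.piecewise_insert, Pi.add_apply, f.map_update_add, he, ih, hy',
        Finset.sum_insert hi]
      abel
  simpa using key Finset.univ

end Brackets

section Ideals

variable {f : AlternatingMap F L L (Fin (n + 2))}

theorem IsIdeal.bracketSpan (hf : IsNLie f) {I : Submodule F L} (hI : IsIdeal f I) :
    IsIdeal f (bracketSpan f (Fin.cons I (Fin.cons I fun _ => ⊤))) := by
  have hC : ∀ j, IsIdeal f
      ((Fin.cons I (Fin.cons I fun _ => ⊤) : Fin (n + 2) → Submodule F L) j) := by
    refine Fin.cases hI (Fin.cases hI fun j => ?_)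
    intro a _
    simp
  refine isIdeal_of_D_mem fun u x hx => ?_
  induction hx using Submodule.span_induction with
  | mem x hx =>
    obtain ⟨c, hc, rfl⟩ := hx
    rw [hf.D_map u]
    refine Submodule.sum_mem _ fun i _ => Submodule.subset_span ⟨_, fun j => ?_, rfl⟩
    rcases eq_or_ne j i with rfl | hj
    · simpa using (hC j).D_mem u (hc j)
    · simpa [hj] using hc j
  | zero => simp
  | add x y _ _ hx hy => rw [_root_.map_add]; exact Submodule.add_mem _ hx hy
  | smul c x _ hx => rw [map_smul]; exact Submodule.smul_mem _ c hx

theorem isIdeal_ds2 (hf : IsNLie f) (s : ℕ) : IsIdeal f (ds2 f s) := by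
  induction s with
  | zero => exact fun _ _ => Submodule.mem_top
  | succ s ih => exact ih.bracketSpan hf

theorem Is2Soluble.exists_isIdeal (hf : IsNLie f) (hsol : Is2Soluble f) {A : Submodule F L}
    (hA : A ≠ ⊤) : ∃ B : Submodule F L, IsIdeal f B ∧ ¬ B ≤ A ∧
      ∀ a : Fin (n + 2) → L, a 0 ∈ B → a 1 ∈ B → f a ∈ A := by
  classical
  have hex : ∃ s, ds2 f s ≤ A := hsol.imp fun r hr => hr.le.trans bot_le
  obtain ⟨s, hs⟩ : ∃ s, Nat.find hex = s + 1 := by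
    refine Nat.exists_eq_succ_of_ne_zero fun h0 => hA (top_le_iff.1 ?_)
    simpa [h0, ds2] using Nat.find_spec hex
  refine ⟨ds2 f s, isIdeal_ds2 hf s, Nat.find_min hex (by omega), fun a h0 h1 => ?_⟩
  have hle : ds2 f (s + 1) ≤ A := hs ▸ Nat.find_spec hex
  refine hle (Submodule.subset_span ⟨a, ?_, rfl⟩)
  exact Fin.cases h0 (Fin.cases h1 fun j => by simp)

theorem IsMinAbelianEmbeddedIdeal.eq_of_le {A : Submodule F L}
    (hA : IsMinAbelianEmbeddedIdeal f A) {B : Submodule F L} (hB : IsIdeal f B) (hle : B ≤ A)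
    (hne : B ≠ ⊥) : B = A := by
  by_contra h
  exact hne (hA.2.2.2 B hB (lt_of_le_of_ne hle h))

/-- Commuting, locally nilpotent operators on a nonzero finite-dimensional space have a common
null vector. -/
theorem exists_common_null [FiniteDimensional F L] {A : Submodule F L} (hA : A ≠ ⊥)
    (T : Set (L →ₗ[F] L)) (hmem : ∀ t ∈ T, ∀ x ∈ A, t x ∈ A)
    (hcomm : ∀ s ∈ T, ∀ t ∈ T, ∀ x ∈ A, s (t x) = t (s x))
    (hnil : ∀ t ∈ T, ∀ x ∈ A, ∃ m, (t ^ m) x = 0) :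
    ∃ x ∈ A, x ≠ 0 ∧ ∀ t ∈ T, t x = 0 := by
  classical
  obtain ⟨N, ⟨hNA, hN, hNT⟩, hmin⟩ := (wellFounded_lt (α := Submodule F L)).has_min
    {N | N ≤ A ∧ N ≠ ⊥ ∧ ∀ t ∈ T, ∀ x ∈ N, t x ∈ N} ⟨A, le_rfl, hA, hmem⟩
  obtain ⟨x, hx, hx0⟩ := N.ne_bot_iff.1 hN
  refine ⟨x, hNA hx, hx0, fun t ht => ?_⟩
  have hpow : ∀ m, (t ^ m) x ∈ N := by
    intro m
    induction m with
    | zero => simpa using hx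
    | succ m ih => rw [pow_succ']; exact hNT t ht _ ih
  have hex := hnil t ht x (hNA hx)
  obtain ⟨m, hm⟩ : ∃ m, Nat.find hex = m + 1 :=
    Nat.exists_eq_succ_of_ne_zero fun h0 => hx0 (by simpa [h0] using Nat.find_spec hex)
  have hker : N ⊓ LinearMap.ker t ≠ ⊥ := by
    refine (Submodule.ne_bot_iff _).2
      ⟨(t ^ m) x, ⟨hpow m, ?_⟩, Nat.find_min hex (by omega)⟩
    have := Nat.find_spec hex
    rw [hm, pow_succ'] at this
    exact this
  have hnlt := hmin (N ⊓ LinearMap.ker t) ⟨inf_le_left.trans hNA, hker, fun s hs y hy =>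
    ⟨hNT s hs y hy.1, by
      have h0 : t y = 0 := hy.2
      change t (s y) = 0
      rw [hcomm t ht s hs y (hNA hy.1), h0, map_zero]⟩⟩
  have heq : N ⊓ LinearMap.ker t = N := by
    by_contra h
    exact hnlt (lt_of_le_of_ne inf_le_left h)
  exact (inf_eq_left.1 heq) hx

variable {A : Submodule F L} {T : Set (Fin (n + 1) → L)}

theorem isIdeal_engel_inf (hf : IsNLie f) (hA : IsIdeal f A)
    (hT : ∀ u, ∀ w ∈ T, ∀ i, Function.update w i (D f u (w i)) ∈ T)
    (hcomm : ∀ u ∈ T, ∀ w ∈ T, ∀ x ∈ A, D f u (D f w x) = D f w (D f u x))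
    {w : Fin (n + 1) → L} (hw : w ∈ T) : IsIdeal f (engel (D f w) ⊓ A) := by
  refine isIdeal_of_D_mem fun u => ?_
  set e : L →ₗ[F] L := ∑ i, D f (Function.update w i (D f u (w i))) with he
  have hDA : ∀ x ∈ A, D f w x ∈ A := fun x hx => hA.D_mem w hx
  have hce : ∀ m, ∀ x ∈ A, ((D f w) ^ m) (e x) = e (((D f w) ^ m) x) := by
    intro m
    induction m with
    | zero => simp
    | succ m ih =>
      intro x hx
      have h1 : D f w (e x) = e (D f w x) := by
        simp only [he, LinearMap.sum_apply, map_sum]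
        exact Finset.sum_congr rfl fun i _ => hcomm w hw _ (hT u w hw i) x hx
      rw [pow_succ, Module.End.mul_apply, Module.End.mul_apply, h1, ih _ (hDA x hx)]
  have key : ∀ m, ∀ x ∈ A, ((D f w) ^ m) x = 0 → ((D f w) ^ (m + 1)) (D f u x) = 0 := by
    intro m
    induction m with
    | zero =>
      intro x _ h
      have hx : x = 0 := by simpa using h
      simp [hx]
    | succ m ih =>
      intro x hx h
      have h1 : D f w (D f u x) = D f u (D f w x) - e x := by
        rw [hf.D_D u w x]; simp [he]
      rw [pow_succ, Module.End.mul_apply, h1, map_sub, hce _ x hx, h, map_zero, sub_zero]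
      refine ih _ (hDA x hx) ?_
      rwa [pow_succ, Module.End.mul_apply] at h
  rintro x ⟨⟨m, hm⟩, hx⟩
  exact ⟨⟨m + 1, key m x hx hm⟩, hA.D_mem u hx⟩

theorem IsMinAbelianEmbeddedIdeal.exists_D_injective [FiniteDimensional F L] (hf : IsNLie f)
    (hA : IsMinAbelianEmbeddedIdeal f A)
    (hT : ∀ u, ∀ w ∈ T, ∀ i, Function.update w i (D f u (w i)) ∈ T)
    (hcomm : ∀ u ∈ T, ∀ w ∈ T, ∀ x ∈ A, D f u (D f w x) = D f w (D f u x))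
    (hne : ∃ w ∈ T, ∃ x ∈ A, D f w x ≠ 0) :
    ∃ w ∈ T, ∀ x ∈ A, D f w x = 0 → x = 0 := by
  by_contra! hcon
  have hAI := hA.2.1
  have hnil : ∀ w ∈ T, ∀ x ∈ A, ∃ m, ((D f w) ^ m) x = 0 := by
    intro w hw x hx
    have h := hA.eq_of_le (isIdeal_engel_inf hf hAI hT hcomm hw) inf_le_right (by
      obtain ⟨y, hy, hy0, hyne⟩ := hcon w hw
      exact (Submodule.ne_bot_iff _).2 ⟨y, ⟨⟨1, by simpa using hy0⟩, hy⟩, hyne⟩)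
    rw [← h] at hx
    exact hx.1
  obtain ⟨x, hx, hx0, hxT⟩ := exists_common_null hA.1 (D f '' T)
    (by rintro _ ⟨w, _, rfl⟩ x hx; exact hAI.D_mem w hx)
    (by rintro _ ⟨u, hu, rfl⟩ _ ⟨w, hw, rfl⟩ x hx; exact hcomm u hu w hw x hx)
    (by rintro _ ⟨w, hw, rfl⟩ x hx; exact hnil w hw x hx)
  have hW : IsIdeal f (A ⊓ ⨅ w ∈ T, LinearMap.ker (D f w)) := by
    refine isIdeal_of_D_mem fun u y hy => ?_
    simp only [Submodule.mem_inf, Submodule.mem_iInf, LinearMap.mem_ker] at hy ⊢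
    refine ⟨hAI.D_mem u hy.1, fun w hw => ?_⟩
    have h := hf.D_D u w y
    rw [hy.2 w hw, map_zero, LinearMap.sum_apply,
      Finset.sum_eq_zero fun i _ => hy.2 _ (hT u w hw i), add_zero] at h
    exact h.symm
  have hWA := hA.eq_of_le hW inf_le_left ((Submodule.ne_bot_iff _).2
    ⟨x, by simpa [hx] using fun w hw => hxT _ ⟨w, hw, rfl⟩, hx0⟩)
  obtain ⟨w, hw, y, hy, hy0⟩ := hne
  rw [← hWA] at hy
  simp only [Submodule.mem_inf, Submodule.mem_iInf, LinearMap.mem_ker] at hy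
  exact hy0 (hy.2 w hw)

open Classical in
/-- If `C_L(A) = A`, some inner derivation involving an element of `B` is injective on `A`. -/
theorem IsMinAbelianEmbeddedIdeal.exists_mem_D_injective [FiniteDimensional F L] (hf : IsNLie f)
    (hA : IsMinAbelianEmbeddedIdeal f A) (hC : centralizer f A = (A : Set L))
    {B : Submodule F L} (hB : IsIdeal f B) (hBA : ¬ B ≤ A)
    (hBB : ∀ a : Fin (n + 2) → L, a 0 ∈ B → a 1 ∈ B → f a ∈ A) :
    ∃ w : Fin (n + 1) → L, (∃ i, w i ∈ B) ∧ ∀ x ∈ A, D f w x = 0 → x = 0 := by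
  set c : (Fin (n + 1) → L) → ℕ := fun u => #{i | u i ∈ B} with hc
  have hc_update : ∀ w i b, (w i ∈ B → b ∈ B) → c w ≤ c (Function.update w i b) := by
    intro w i b hb
    refine Finset.card_le_card fun j hj => ?_
    rcases eq_or_ne j i with rfl | hji
    · simpa using hb (by simpa using hj)
    · simpa [hji] using hj
  have hc_update' : ∀ w i b, w i ∉ B → b ∈ B → c w + 1 ≤ c (Function.update w i b) := by
    intro w i b hw hb
    rw [hc, ← Finset.card_insert_of_notMem (a := i) (by simpa using hw)]
    refine Finset.card_le_card fun j hj => ?_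
    rcases eq_or_ne j i with rfl | hji
    · simpa using hb
    · simpa [hji] using hj
  have hpos : ∀ w, 1 ≤ c w → ∃ i, w i ∈ B := by
    intro w hw
    obtain ⟨i, hi⟩ := Finset.card_pos.1 hw
    exact ⟨i, by simpa using hi⟩
  let P : ℕ → Prop := fun k => ∃ w, k ≤ c w ∧ ∃ x ∈ A, D f w x ≠ 0
  have hP1 : P 1 := by
    obtain ⟨b, hb, hbA⟩ := Set.not_subset.1 hBA
    rw [← hC] at hbA
    simp only [centralizer, Set.mem_ofPred_eq, not_forall] at hbA
    obtain ⟨a, ha, y, hy⟩ := hbA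
    set z : Fin (n + 2) → L := Fin.cons b (Fin.cons a y)
    have hz : f (z ∘ Equiv.swap 1 (Fin.last _)) ≠ 0 := fun h0 =>
      hy ((Submodule.mem_bot F).1 ((map_perm_mem_iff ⊥ z _).1 ((Submodule.mem_bot F).2 h0)))
    refine ⟨Fin.init (z ∘ Equiv.swap 1 (Fin.last _)), ?_, a, ha, ?_⟩
    · refine Finset.card_pos.2 ⟨0, ?_⟩
      have h0 : Equiv.swap 1 (Fin.last (n + 1)) 0 = 0 :=
        Equiv.swap_apply_of_ne_of_ne (by simp) (Fin.last_pos).ne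
      rw [Finset.mem_filter_univ]
      simpa [Fin.init, h0, z] using hb
    · rw [D_apply]
      rw [← Fin.snoc_init_self (z ∘ Equiv.swap 1 (Fin.last _))] at hz
      simpa [z] using hz
  set k := Nat.findGreatest P (n + 1)
  have hk1 : 1 ≤ k := Nat.le_findGreatest (by omega) hP1
  have hPk : P k := Nat.findGreatest_spec (P := P) (by omega : 1 ≤ n + 1) hP1
  have hmax : ∀ w, k + 1 ≤ c w → ∀ x ∈ A, D f w x = 0 := by
    intro w hw x hx
    by_contra h
    have hle : c w ≤ n + 1 := (Finset.card_le_univ _).trans (by simp)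
    exact Nat.findGreatest_is_greatest (P := P) (Nat.lt_succ_self k) (hw.trans hle)
      ⟨w, hw, x, hx, h⟩
  obtain ⟨w, hw, hinj⟩ := hA.exists_D_injective hf (T := {w | k ≤ c w})
    (fun u w hw i => hw.trans (hc_update w i _ fun h => hB.D_mem u h))
    (by
      intro u hu w hw x hx
      obtain ⟨j, hj⟩ := hpos u (hk1.trans hu)
      rw [hf.D_D u w x, LinearMap.sum_apply, Finset.sum_eq_zero, add_zero]
      intro i _
      by_cases hi : w i ∈ B
      · refine hA.2.2.1.D_eq_zero (i := i) ?_ hx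
        rw [Function.update_self]
        exact map_mem_of_pair hBB (Fin.castSucc_lt_last j).ne (by simpa using hj)
          (by simpa using hi)
      · exact hmax _ ((Nat.succ_le_succ hw).trans
          (hc_update' w i _ hi (hB.D_mem_of_mem j hj _))) x hx)
    hPk
  exact ⟨w, hpos w (hk1.trans hw), hinj⟩

end Ideals

section Conjugation

variable {f : AlternatingMap F L L (Fin (n + 2))} {A U : Submodule F L}

theorem exists_sub_mem_of_sup_eq_top {ι : Type*} (h : U ⊔ A = ⊤) (w : ι → L) :
    ∃ u : ι → L, (∀ i, u i ∈ U) ∧ ∀ i, w i - u i ∈ A := by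
  have hex : ∀ i, ∃ u ∈ U, w i - u ∈ A := fun i => by
    obtain ⟨y, hy, b, hb, hyb⟩ := Submodule.mem_sup.1 (h ▸ Submodule.mem_top : w i ∈ U ⊔ A)
    exact ⟨y, hy, by simpa [← hyb] using hb⟩
  choose u hu hwu using hex
  exact ⟨u, hu, hwu⟩

theorem IsSubalg.D_mem (hU : IsSubalg f U) {u : Fin (n + 1) → L} (hu : ∀ i, u i ∈ U) {x : L}
    (hx : x ∈ U) : D f u x ∈ U :=
  hU _ (Fin.lastCases (by simpa using hx) fun i => by simpa using hu i)

theorem D_D_eq_zero (hU : IsSubalg f U) (hUA : U ⊓ A = ⊥) (hA : IsIdeal f A)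
    {u w : Fin (n + 1) → L} (hu : ∀ i, u i ∈ U) (hwu : ∀ i, w i - u i ∈ A)
    (hw : ∀ x, D f w (D f w x) ∈ A) {x : L} (hx : x ∈ U) : D f u (D f u x) = 0 := by
  rw [← Submodule.mem_bot F, ← hUA]
  refine ⟨hU.D_mem hu (hU.D_mem hu hx), ?_⟩
  have h1 := A.sub_mem (A.sub_mem (hw x) (hA.D_mem w (D_sub_D_mem hA hwu x)))
    (D_sub_D_mem hA hwu (D f u x))
  simpa using h1

theorem exists_D_update_eq_D_cons (u : Fin (n + 1) → L) (i : Fin (n + 1)) {a : L} (ha : a ∈ A) :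
    ∃ b ∈ A, ∃ y : Fin n → L, D f (Function.update u i a) = D f (Fin.cons b y) := by
  set w := Function.update u i a with hw
  rcases eq_or_ne 0 i with rfl | hi
  · exact ⟨a, ha, Fin.tail w, by rw [← Fin.cons_self_tail w]; simp [hw]⟩
  · refine ⟨-a, A.neg_mem ha, Fin.tail (w ∘ Equiv.swap 0 i), LinearMap.ext fun x => ?_⟩
    have h1 : (Fin.cons a (Fin.tail (w ∘ Equiv.swap 0 i)) : Fin (n + 1) → L) =
        w ∘ Equiv.swap 0 i := by
      rw [← Fin.cons_self_tail (w ∘ Equiv.swap 0 i)]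
      simp [hw]
    have h2 : (Fin.snoc (w ∘ Equiv.swap 0 i) x : Fin (n + 2) → L) =
        (Fin.snoc w x : Fin (n + 2) → L) ∘ Equiv.swap (Fin.castSucc 0) i.castSucc := by
      funext j
      refine Fin.lastCases ?_ (fun j => ?_) j
      · rw [Function.comp_apply, Equiv.swap_apply_of_ne_of_ne (Fin.castSucc_lt_last 0).ne'
          (Fin.castSucc_lt_last i).ne', Fin.snoc_last, Fin.snoc_last]
      · rw [Function.comp_apply, (Fin.castSucc_injective _).swap_apply, Fin.snoc_castSucc,
          Fin.snoc_castSucc, Function.comp_apply]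
    have h3 : D f (Fin.cons (-a) (Fin.tail (w ∘ Equiv.swap 0 i))) =
        -D f (Fin.cons a (Fin.tail (w ∘ Equiv.swap 0 i))) := by
      simpa [curryRight_eq_D] using
        f.toMultilinearMap.curryRight.cons_smul (Fin.tail (w ∘ Equiv.swap 0 i)) (-1) a
    rw [h3, h1, LinearMap.neg_apply, D_apply _ x, D_apply _ x, h2,
      f.map_swap _ ((Fin.castSucc_injective _).ne hi), neg_neg]

theorem IsAInner.id_add_comp {α : L →ₗ[F] L} (hα : IsAInner f A α) (u : Fin (n + 1) → L)
    (i : Fin (n + 1)) {a : L} (ha : a ∈ A) :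
    IsAInner f A ((LinearMap.id + D f (Function.update u i a)) ∘ₗ α) := by
  obtain ⟨m, g, hg, rfl⟩ := hα
  obtain ⟨b, hb, y, hby⟩ := exists_D_update_eq_D_cons (f := f) u i ha
  refine ⟨m + 1, Fin.cons (LinearMap.id + D f (Function.update u i a)) g,
    Fin.cases ⟨b, y, hb, by simp [hby]⟩ fun j => by simpa using hg j, ?_⟩
  simp [List.ofFn_succ, Module.End.mul_eq_comp]

theorem IsAbelianEmbedded.id_add_D_map (hf : IsNLie f) (hI : IsIdeal f A)
    (hA : IsAbelianEmbedded f A) {u : Fin (n + 1) → L} {i : Fin (n + 1)} (hu : u i ∈ A)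
    (x : Fin (n + 2) → L) :
    (LinearMap.id + D f u : L →ₗ[F] L) (f x) = f ((LinearMap.id + D f u : L →ₗ[F] L) ∘ x) := by
  have h := hA.map_add x (y := D f u ∘ x) fun j => hI.D_mem_of_mem i hu _
  rw [LinearMap.add_apply, hf.D_map u]
  exact h.symm

theorem D_update_apply_self (u : Fin (n + 1) → L) (i : Fin (n + 1)) (c : L) :
    D f (Function.update u i c) (u i) = -D f u c := by
  rw [D_apply, D_apply, ← f.map_swap _ (Fin.castSucc_lt_last i).ne]
  congr 1
  funext j
  refine Fin.lastCases (by simp) (fun j => ?_) j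
  rcases eq_or_ne j i with rfl | hj
  · simp
  · rw [Function.comp_apply, Equiv.swap_apply_of_ne_of_ne ((Fin.castSucc_injective _).ne hj)
      (Fin.castSucc_lt_last j).ne]
    simp [hj]

theorem D_update_apply_of_ne (u : Fin (n + 1) → L) {i j : Fin (n + 1)} (hj : j ≠ i) (c : L) :
    D f (Function.update u i c) (u j) = 0 :=
  f.map_eq_zero_of_eq _ (by simp [hj]) (Fin.castSucc_lt_last j).ne

theorem exists_isAInner_map_eq_add [FiniteDimensional F L] (hf : IsNLie f) (hI : IsIdeal f A)
    (hA : IsAbelianEmbedded f A) {u : Fin (n + 1) → L} (hu : ∀ x ∈ A, D f u x = 0 → x = 0)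
    {a : Fin (n + 1) → L} (ha : ∀ i, a i ∈ A) (s : Finset (Fin (n + 1))) :
    ∃ α : L →ₗ[F] L, IsAInner f A α ∧ (∀ x, α (f x) = f (α ∘ x)) ∧ (∀ x, α x - x ∈ A) ∧
      ∀ i, α (u i) = u i + if i ∈ s then a i else 0 := by
  have hsurj : ∀ b ∈ A, ∃ c ∈ A, D f u c = b := by
    have hinj : Function.Injective ((D f u).restrict fun x hx => hI.D_mem u hx) := by
      refine (injective_iff_map_eq_zero _).2 fun x hx => Subtype.ext (hu x x.2 ?_)
      simpa using congrArg Subtype.val hx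
    intro b hb
    obtain ⟨c, hc⟩ := LinearMap.injective_iff_surjective.1 hinj ⟨b, hb⟩
    exact ⟨c, c.2, by simpa using congrArg Subtype.val hc⟩
  induction s using Finset.induction_on with
  | empty =>
    exact ⟨LinearMap.id, ⟨0, Fin.elim0, fun j => j.elim0, by simp; rfl⟩, fun _ => rfl, by simp,
      by simp⟩
  | insert i s hi ih =>
    obtain ⟨α, hα, hαf, hαA, hαu⟩ := ih
    obtain ⟨c, hc, hca⟩ := hsurj _ (A.neg_mem (ha i))
    have hci : Function.update u i c i ∈ A := by simpa using hc
    refine ⟨_, hα.id_add_comp u i hc, fun x => ?_, fun x => ?_, fun j => ?_⟩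
    · rw [LinearMap.comp_apply, hαf, hA.id_add_D_map hf hI hci]
      rfl
    · have h := A.add_mem (hαA x) (hI.D_mem_of_mem i hci (α x))
      rwa [sub_add_eq_add_sub] at h
    · have h0 : D f (Function.update u i c) (if j ∈ s then a j else 0) = 0 :=
        hA.D_eq_zero hci (by split_ifs <;> simp [ha])
      rw [LinearMap.comp_apply, hαu, _root_.map_add, LinearMap.add_apply, LinearMap.add_apply, h0]
      rcases eq_or_ne j i with rfl | hj
      · simp [hi, D_update_apply_self, hca]
      · simp [hj, D_update_apply_of_ne]

end Conjugation

/-- In a finite-dimensional 2-soluble `n`-Lie algebra `L` with minimal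
abelian embedded ideal `A` satisfying `C_L(A) = A`, any two complements to `A` in `L`
are `A`-conjugate. -/
theorem stmt12 {F : Type*} [Field F] {L : Type*} [AddCommGroup L] [Module F L]
    [FiniteDimensional F L] {n : ℕ} (f : AlternatingMap F L L (Fin (n + 2)))
    (hf : IsNLie f) (hsol : Is2Soluble f)
    (A : Submodule F L) (hA : IsMinAbelianEmbeddedIdeal f A)
    (hC : centralizer f A = (A : Set L))
    (U V : Submodule F L)
    (hU : IsSubalg f U) (hU1 : U ⊔ A = ⊤) (hU2 : U ⊓ A = ⊥)
    (hV : IsSubalg f V) (hV1 : V ⊔ A = ⊤) (hV2 : V ⊓ A = ⊥) :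
    ∃ α : L →ₗ[F] L, IsAInner f A α ∧ Submodule.map α U = V := by
  obtain rfl | hAtop := eq_or_ne A ⊤
  · rw [inf_top_eq] at hU2 hV2
    exact ⟨LinearMap.id, ⟨0, Fin.elim0, fun j => j.elim0, by simp; rfl⟩, by simp [hU2, hV2]⟩
  have hAI := hA.2.1
  have hAA := hA.2.2.1
  obtain ⟨B, hB, hBA, hBB⟩ := hsol.exists_isIdeal hf hAtop
  obtain ⟨w, ⟨i, hi⟩, hinj⟩ := hA.exists_mem_D_injective hf hC hB hBA hBB
  have hsq : ∀ x, D f w (D f w x) ∈ A := fun x =>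
    map_mem_of_pair hBB (Fin.castSucc_lt_last i).ne (by simpa using hi)
      (by simpa using hB.D_mem_of_mem i hi x)
  obtain ⟨u, huU, hwu⟩ := exists_sub_mem_of_sup_eq_top hU1 w
  obtain ⟨v, hvV, hwv⟩ := exists_sub_mem_of_sup_eq_top hV1 w
  have hDu : ∀ x ∈ A, D f u x = 0 → x = 0 := fun x hx h =>
    hinj x hx ((hAA.D_congr hwu hx).trans h)
  have hDv : ∀ x ∈ A, D f v x = 0 → x = 0 := fun x hx h =>
    hinj x hx ((hAA.D_congr hwv hx).trans h)
  obtain ⟨α, hα, hαf, hαA, hαu⟩ := exists_isAInner_map_eq_add hf hAI hAA hDu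
    (a := fun i => v i - u i)
    (fun i => by simpa using A.sub_mem (hwu i) (hwv i)) Finset.univ
  have hαu' : α ∘ u = v := by
    funext i
    simp [hαu]
  have hαD : ∀ x, α (D f u x) = D f v (α x) := by
    intro x
    rw [D_apply, hαf, Fin.comp_snoc, hαu', D_apply]
  have hle : Submodule.map α U ≤ V := by
    rintro _ ⟨x, hx, rfl⟩
    obtain ⟨y, hy, b, hb, hyb⟩ := Submodule.mem_sup.1 (hV1 ▸ Submodule.mem_top : α x ∈ V ⊔ A)
    have h0 : D f v (D f v b) = 0 := by
      have h1 := congrArg (fun z => D f v (D f v z)) hyb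
      simpa [D_D_eq_zero hV hV2 hAI hvV hwv hsq hy, ← hαD,
        D_D_eq_zero hU hU2 hAI huU hwu hsq hx] using h1
    have hb0 : b = 0 := hDv b hb (hDv _ (hAI.D_mem v hb) h0)
    rwa [← hyb, hb0, add_zero]
  refine ⟨α, hα, eq_of_le_of_inf_le_of_sup_le (z := A) hle (by simp [hV2]) ?_⟩
  rw [hV1, ← hU1]
  refine sup_le (fun x hx => ?_) le_sup_right
  rw [← sub_sub_cancel (α x) x]
  exact Submodule.sub_mem _ (Submodule.mem_sup_left ⟨x, hx, rfl⟩)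
    (Submodule.mem_sup_right (hαA x))

end NLie
end

section
/- Let L be an n-Lie algebra of dimension k over a field F with at least k+1 elements. Let U be a subalgebra of L, and suppose that E = E_L(d0) for some d0 ∈ D(U) is minimal with respect to inclusion in the set {E_L(d) : d ∈ D(U)} and that U ⊆ E. Then E ⊆ E_L(d) for every d ∈ D(U). -/
namespace NLie

open Finset

variable {F : Type*} [Field F] {L : Type*} [AddCommGroup L] [Module F L] {n : ℕ}

theorem IsDerivation.of_mem_Dspan {f : AlternatingMap F L L (Fin (n + 2))} (hf : IsNLie f)
    {U : Submodule F L} {d : L →ₗ[F] L} (hd : d ∈ Dspan f U) : IsDerivation f d := by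
  induction hd using Submodule.span_induction with
  | mem d h =>
    obtain ⟨a, -, rfl⟩ := h
    exact fun x => hf a x
  | zero =>
    intro x
    refine (Finset.sum_eq_zero fun i _ => ?_).symm
    exact f.map_coord_zero i (by simp)
  | add d e _ _ hd he =>
    intro x
    simp [hd x, he x, Finset.sum_add_distrib]
  | smul c d _ hd =>
    intro x
    simp [hd x, Finset.smul_sum]

theorem mem_engel_of_map_mem {d : L →ₗ[F] L} {x : L} (h : d x ∈ engel d) : x ∈ engel d := by
  obtain ⟨r, hr⟩ := h
  exact ⟨r + 1, by rw [pow_succ]; exact hr⟩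

/-- The Engel subspace of a derivation is a subalgebra. -/
theorem isSubalg_engel {f : AlternatingMap F L L (Fin (n + 2))} {d : L →ₗ[F] L}
    (hd : IsDerivation f d) : IsSubalg f (engel d) := by
  suffices H : ∀ (N : ℕ) (x : Fin (n + 2) → L) (r : Fin (n + 2) → ℕ),
      ∑ i, r i = N → (∀ i, (d ^ r i) (x i) = 0) → f x ∈ engel d by
    intro a ha
    choose r hr using ha
    exact H _ a r rfl hr
  intro N
  induction N using Nat.strong_induction_on with
  | _ N ih =>
    intro x r hN hr
    by_cases h0 : ∃ i, r i = 0
    · obtain ⟨i, hi⟩ := h0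
      have hx : x i = 0 := by simpa [hi] using hr i
      rw [f.map_coord_zero i hx]
      exact zero_mem _
    · push Not at h0
      apply mem_engel_of_map_mem
      rw [hd x]
      refine sum_mem fun i _ => ih _ ?_ _ (Function.update r i (r i - 1)) rfl fun j => ?_
      · rw [← hN]
        refine Finset.sum_lt_sum (fun j _ => ?_) ⟨i, Finset.mem_univ i, ?_⟩
        · by_cases h : j = i
          · subst h; simp
          · simp [h]
        · have := h0 i
          simp only [Function.update_self]
          omega
      · by_cases h : j = i
        · subst h
          have := hr j
          rw [← Nat.sub_add_cancel (Nat.one_le_iff_ne_zero.2 (h0 j)), pow_succ] at this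
          simpa using this
        · simpa [h] using hr j

/-- A subalgebra containing `U` is invariant under `D(U)`. -/
theorem map_mem_of_mem_Dspan {f : AlternatingMap F L L (Fin (n + 2))} {U E : Submodule F L}
    (hE : IsSubalg f E) (hUE : U ≤ E) {d : L →ₗ[F] L} (hd : d ∈ Dspan f U) :
    ∀ x ∈ E, d x ∈ E := by
  intro x hx
  induction hd using Submodule.span_induction with
  | mem d h =>
    obtain ⟨a, ha, rfl⟩ := h
    refine hE _ fun i => ?_
    induction i using Fin.lastCases with
    | last => simpa using hx
    | cast i => simpa using hUE (ha i)
  | zero => simp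
  | add d e _ _ hd he => exact add_mem hd he
  | smul c d _ hd => exact E.smul_mem c hd

/-- The matrix coefficients of `(A + tB)ʳ` are polynomials of degree at most `r` in `t`. -/
theorem exists_polynomial_eval_eq_pow {M : Type*} [AddCommGroup M] [Module F M]
    (A B : M →ₗ[F] M) (x : M) (r : ℕ) (φ : M →ₗ[F] F) :
    ∃ p : Polynomial F, p.natDegree ≤ r ∧
      ∀ t : F, p.eval t = φ (((A + t • B) ^ r) x) := by
  induction r generalizing φ with
  | zero => exact ⟨Polynomial.C (φ x), by simp, by simp⟩
  | succ r ih =>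
    obtain ⟨p, hp, hpe⟩ := ih (φ ∘ₗ A)
    obtain ⟨q, hq, hqe⟩ := ih (φ ∘ₗ B)
    refine ⟨p + Polynomial.X * q, ?_, fun t => ?_⟩
    · refine Polynomial.natDegree_add_le_of_degree_le (by omega) ?_
      refine Polynomial.natDegree_mul_le.trans ?_
      have := Polynomial.natDegree_X_le (R := F)
      omega
    · simp [hpe, hqe, pow_succ']

/-- If `(A + tB)ʳ` vanishes for more than `r` values of `t`, it vanishes for all `t`. -/
theorem pow_add_smul_eq_zero {M : Type*} [AddCommGroup M] [Module F M]
    (A B : M →ₗ[F] M) (r : ℕ) (S : Finset F) (hS : r < S.card)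
    (h : ∀ t ∈ S, (A + t • B) ^ r = 0) (t : F) : (A + t • B) ^ r = 0 := by
  ext x
  refine (Module.forall_dual_apply_eq_zero_iff F _).1 fun φ => ?_
  obtain ⟨p, hp, hpe⟩ := exists_polynomial_eval_eq_pow A B x r φ
  have hp0 : p = 0 := by
    refine Polynomial.eq_zero_of_natDegree_lt_card_of_eval_eq_zero' p S (fun c hc => ?_)
      (hp.trans_lt hS)
    simp [hpe, h c hc]
  rw [← hpe, hp0, Polynomial.eval_zero]

/-- If `A` is invertible, then `A + tB` is singular for at most `dim M` values of `t`. -/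
theorem exists_finset_injective_add_smul {M : Type*} [AddCommGroup M] [Module F M]
    [FiniteDimensional F M] (A B : M →ₗ[F] M) (hA : Function.Injective A) :
    ∃ T : Finset F, T.card ≤ Module.finrank F M ∧
      ∀ t ∉ T, Function.Injective (A + t • B) := by
  classical
  let b := Module.finBasis F M
  let A' := LinearMap.toMatrix b b A
  let B' := LinearMap.toMatrix b b B
  let q : Polynomial F :=
    (((Polynomial.X : Polynomial F) • B'.map Polynomial.C + A'.map Polynomial.C)).det
  have hq : q.natDegree ≤ Module.finrank F M := by
    simpa using Polynomial.natDegree_det_X_add_C_le B' A'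
  have hqe (t : F) : q.eval t = LinearMap.det (A + t • B) := by
    rw [← LinearMap.det_toMatrix b, map_add, map_smul, add_comm]
    change (Polynomial.evalRingHom t) (Matrix.det _) = _
    rw [RingHom.map_det]
    congr 1
    ext i j
    simp only [A', B', Polynomial.coe_evalRingHom, RingHom.mapMatrix_apply, Matrix.map_apply,
      Matrix.add_apply, Matrix.smul_apply, smul_eq_mul, Polynomial.eval_add, Polynomial.eval_mul,
      Polynomial.eval_X, Polynomial.eval_C]
  have hq0 : q ≠ 0 := by
    intro h
    have h0 := hqe 0
    rw [h, Polynomial.eval_zero, zero_smul, add_zero] at h0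
    exact (LinearMap.bot_lt_ker_of_det_eq_zero h0.symm).ne' (LinearMap.ker_eq_bot.2 hA)
  refine ⟨q.roots.toFinset, (Multiset.toFinset_card_le _).trans ((q.card_roots').trans hq),
    fun t ht => ?_⟩
  rw [← LinearMap.ker_eq_bot]
  by_contra hker
  refine ht ?_
  rw [Multiset.mem_toFinset, Polynomial.mem_roots hq0, Polynomial.IsRoot, hqe]
  by_contra hdet
  exact hker (LinearMap.ker_eq_bot.2 (LinearMap.equivOfDetNeZero _ hdet).injective)

/-- If `d` preserves `E` and acts injectively on `L/E`, then `E_L(d) ⊆ E`. -/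
theorem engel_le_of_mapQ_injective {E : Submodule F L} {d : L →ₗ[F] L} (hE : E ≤ E.comap d)
    (h : Function.Injective (E.mapQ E d hE)) : engel d ≤ E := by
  rintro x ⟨r, hr⟩
  have hstep (y : L) (hy : d y ∈ E) : y ∈ E := by
    rw [← Submodule.Quotient.mk_eq_zero] at hy ⊢
    exact h (by simpa using hy)
  induction r generalizing x with
  | zero =>
    obtain rfl : x = 0 := hr
    exact E.zero_mem
  | succ r ih => exact hstep x (ih (by simpa [pow_succ] using hr))

/-- `d` acts injectively on `L/E_L(d)`. -/
theorem mapQ_engel_injective {E : Submodule F L} {d : L →ₗ[F] L} (h : E = engel d)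
    (hE : E ≤ E.comap d) : Function.Injective (E.mapQ E d hE) := by
  rw [← LinearMap.ker_eq_bot, LinearMap.ker_eq_bot']
  intro y hy
  obtain ⟨x, rfl⟩ := E.mkQ_surjective y
  simp only [Submodule.mkQ_apply, Submodule.mapQ_apply, Submodule.Quotient.mk_eq_zero] at hy ⊢
  subst h
  exact mem_engel_of_map_mem hy

theorem restrict_pow_finrank_eq_zero [FiniteDimensional F L] {E : Submodule F L}
    {d : L →ₗ[F] L} (hE : ∀ x ∈ E, d x ∈ E) (h : E ≤ engel d) :
    d.restrict hE ^ Module.finrank F E = 0 := by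
  ext1 x
  obtain ⟨r, hr⟩ := h x.2
  have hx : (d.restrict hE ^ r) x = 0 := by
    rw [Module.End.pow_restrict]
    exact Subtype.ext hr
  have := Module.End.ker_pow_le_ker_pow_finrank (d.restrict hE) r hx
  simpa using this

/-- Let `L` have dimension `k` over a field `F` with at least `k + 1`
elements, let `U ≤ L` be a subalgebra, and suppose `E = E_L(d₀)`, `d₀ ∈ D(U)`, is minimal
in `{E_L(d) : d ∈ D(U)}` and `U ⊆ E`.  Then `E ⊆ E_L(d)` for all `d ∈ D(U)`. -/
theorem stmt14 {F : Type*} [Field F] {L : Type*} [AddCommGroup L] [Module F L]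
    [FiniteDimensional F L] {n : ℕ}
    (hF : (Module.finrank F L : Cardinal) + 1 ≤ Cardinal.mk F)
    (f : AlternatingMap F L L (Fin (n + 2)))
    (hf : IsNLie f) (U : Submodule F L) (hU : IsSubalg f U)
    (d0 : L →ₗ[F] L) (hd0 : d0 ∈ Dspan f U)
    (hmin : ∀ d ∈ Dspan f U, engel d ≤ engel d0 → engel d = engel d0)
    (hUE : U ≤ engel d0) :
    ∀ d ∈ Dspan f U, engel d0 ≤ engel d := by
  classical
  intro d hd
  obtain ⟨S, hS⟩ : ∃ S : Finset F, Module.finrank F L + 1 ≤ S.card :=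
    Cardinal.exists_finset_le_card F _ (by exact_mod_cast hF)
  set E := engel d0 with hE
  have hsub : IsSubalg f E := isSubalg_engel (.of_mem_Dspan hf hd0)
  have hinv {e : L →ₗ[F] L} (he : e ∈ Dspan f U) : ∀ x ∈ E, e x ∈ E :=
    map_mem_of_mem_Dspan hsub hUE he
  have hB : d - d0 ∈ Dspan f U := sub_mem hd hd0
  have hpencil (t : F) : d0 + t • (d - d0) ∈ Dspan f U :=
    add_mem hd0 (Submodule.smul_mem _ t hB)
  obtain ⟨T, hT, hTinj⟩ := exists_finset_injective_add_smul (E.mapQ E d0 (hinv hd0))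
    (E.mapQ E (d - d0) (hinv hB)) (mapQ_engel_injective hE _)
  have hnil : ∀ t ∈ S \ T, (d0.restrict (hinv hd0) + t • (d - d0).restrict (hinv hB)) ^
      Module.finrank F E = 0 := by
    intro t ht
    have hinj := hTinj t (Finset.mem_sdiff.1 ht).2
    have hle : engel (d0 + t • (d - d0)) ≤ E := by
      refine engel_le_of_mapQ_injective (hinv (hpencil t)) ?_
      convert hinj using 2
      ext x
      simp
    exact restrict_pow_finrank_eq_zero (hinv (hpencil t)) (hmin _ (hpencil t) hle).ge
  have hcard : Module.finrank F E < (S \ T).card := by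
    have := Finset.le_card_sdiff T S
    have := E.finrank_quotient_add_finrank
    omega
  have hone := pow_add_smul_eq_zero _ _ _ _ hcard hnil 1
  intro x hx
  refine ⟨Module.finrank F E, ?_⟩
  have hd1 : d0.restrict (hinv hd0) + (1 : F) • (d - d0).restrict (hinv hB) =
      d.restrict (hinv hd) := by
    ext y
    simp
  rw [hd1, Module.End.pow_restrict] at hone
  exact congrArg Subtype.val (LinearMap.congr_fun hone ⟨x, hx⟩)

end NLie
end
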